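/- arXiv:1908.07178 — 12 statements merged into one kernel-verified Lean document; each statement's English description precedes it below -/
import Mathlib

section
/- Let q, r, v be positive integers with q ≥ 6 and let F : ℕ →₀ ℕ be a finitely supported function with F 0 = 0 such that 4·(∑_s F s) = r·(q-2)·v + 4·r and 2·(∑_s s·(F s)) = q·r·v. Then (q+2)·(F 1) + 4·(F 2) ≥ 2·q·r. -/
/-- In a maximal diagram of a rank-`r`, order-`q ≥ 6` tensor model, with
`F s` the number of index loops passing through exactly `s` vertices,
`(q+2)·F 1 + 4·F 2 ≥ 2qr`. -/
theorem loop_count_inequality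
    (q r v : ℕ) (hq : 6 ≤ q) (hr : 0 < r) (hv : 0 < v)
    (F : ℕ →₀ ℕ) (hF0 : F 0 = 0)
    (hsum : 4 * (F.sum fun _ y => y) = r * (q - 2) * v + 4 * r)
    (hwsum : 2 * (F.sum fun s y => s * y) = q * r * v) :
    2 * q * r ≤ (q + 2) * F 1 + 4 * F 2 := by
  obtain ⟨p, rfl⟩ : ∃ p, q = p + 2 := ⟨q - 2, by omega⟩
  have hp : 4 ≤ p := by omega
  rw [Nat.add_sub_cancel] at hsum
  have pointwise : ∀ s, 2 * (p + 2) * F s ≤ p * (s * F s)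
      + (if s = 1 then (p + 4) * F 1 else 0) + (if s = 2 then 4 * F 2 else 0) := by
    intro s
    match s with
    | 0 => simp [hF0]
    | 1 => simp; nlinarith
    | 2 => simp; nlinarith
    | s + 3 =>
      have h : 2 * (p + 2) ≤ p * (s + 3) := by nlinarith [Nat.zero_le (p * s)]
      simpa [mul_assoc] using Nat.mul_le_mul_right (F (s + 3)) h
  have summed := Finset.sum_le_sum fun s (_ : s ∈ F.support) => pointwise s
  rw [Finset.sum_add_distrib, Finset.sum_add_distrib, ← Finset.mul_sum, ← Finset.mul_sum,
    Finset.sum_ite_eq', Finset.sum_ite_eq'] at summed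
  have h₁ : (if 1 ∈ F.support then (p + 4) * F 1 else 0) ≤ (p + 4) * F 1 := by
    split_ifs <;> simp
  have h₂ : (if 2 ∈ F.support then 4 * F 2 else 0) ≤ 4 * F 2 := by
    split_ifs <;> simp
  simp only [Finsupp.sum] at hsum hwsum
  nlinarith [congrArg ((p + 2) * ·) hsum, congrArg (p * ·) hwsum]
end

section
/- Let q, r, v be positive integers with q ≥ 6 and let F : ℕ →₀ ℕ be a finitely supported function with F 0 = 0 such that 4·(∑_s F s) = r·(q-2)·v + 4·r and 2·(∑_s s·(F s)) = q·r·v. Then F 1 ≥ 1 or F 2 ≥ 1; that is, there is at least one loop passing through exactly one vertex or at least one loop passing through exactly two vertices. -/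
/-- If `F` vanishes below `k`, its weighted sum is at least `k` times its total. -/
theorem mul_sum_le_weighted_sum (k : ℕ) (F : ℕ →₀ ℕ) (hF : ∀ s < k, F s = 0) :
    k * (F.sum fun _ y => y) ≤ F.sum fun s y => s * y := by
  rw [Finsupp.sum, Finsupp.sum, Finset.mul_sum]
  refine Finset.sum_le_sum fun s hs => Nat.mul_le_mul_right _ ?_
  by_contra! h
  exact Finsupp.mem_support_iff.mp hs (hF s h)

/-- Any maximal non-trivial diagram contains a loop passing through
exactly one vertex or a loop passing through exactly two vertices. -/
theorem exists_one_cycle_or_two_cycle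
    (q r v : ℕ) (hq : 6 ≤ q) (hr : 0 < r) (hv : 0 < v)
    (F : ℕ →₀ ℕ) (hF0 : F 0 = 0)
    (hsum : 4 * (F.sum fun _ y => y) = r * (q - 2) * v + 4 * r)
    (hwsum : 2 * (F.sum fun s y => s * y) = q * r * v) :
    1 ≤ F 1 ∨ 1 ≤ F 2 := by
  by_contra! h
  have hle := mul_sum_le_weighted_sum 3 F fun s hs => by
    interval_cases s <;> omega
  obtain ⟨p, rfl⟩ := Nat.exists_eq_add_of_le hq
  rw [show 6 + p - 2 = p + 4 by omega] at hsum
  nlinarith [Nat.zero_le (p * r * v)]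
end

section
/- The octahedron interaction is maximally-single-trace: for each of the six pairs of distinct colour classes of the octahedron interaction graph, the simple graph on {1,…,6} whose edge set is the union of those two perfect matchings is connected (hence a single 6-cycle). -/
/-- A graph containing a walk that visits every vertex is connected. -/
theorem SimpleGraph.connected_of_surjective_of_adj_succ {V : Type*} {G : SimpleGraph V} {n : ℕ}
    (f : Fin (n + 1) → V) (hf : Function.Surjective f)
    (h : ∀ i : Fin n, G.Adj (f i.castSucc) (f i.succ)) : G.Connected := by
  have reach : ∀ i, G.Reachable (f 0) (f i) := by
    intro i
    induction i using Fin.induction with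
    | zero => rfl
    | succ i ih => exact ih.trans (h i).reachable
  rw [SimpleGraph.connected_iff_exists_forall_reachable]
  exact ⟨f 0, hf.forall.2 reach⟩


/-- The red colour class `{{1,2},{3,4},{5,6}}` of the octahedron interaction
(vertices as `Fin 6`, with `i` standing for vertex `i+1`). -/
def octRed : Set (Sym2 (Fin 6)) := {s(0, 1), s(2, 3), s(4, 5)}

/-- The green colour class `{{1,6},{2,3},{4,5}}` of the octahedron interaction. -/
def octGreen : Set (Sym2 (Fin 6)) := {s(0, 5), s(1, 2), s(3, 4)}

/-- The blue colour class `{{1,3},{2,5},{4,6}}` of the octahedron interaction. -/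
def octBlue : Set (Sym2 (Fin 6)) := {s(0, 2), s(1, 4), s(3, 5)}

/-- The yellow colour class `{{1,4},{2,6},{3,5}}` of the octahedron interaction. -/
def octYellow : Set (Sym2 (Fin 6)) := {s(0, 3), s(1, 5), s(2, 4)}

/-- The octahedron interaction is maximally-single-trace: the union of
any two distinct colour classes forms a connected simple graph on `{1,…,6}`. -/
theorem octahedron_maximally_single_trace :
    ∀ C ∈ ({octRed, octGreen, octBlue, octYellow} : Set (Set (Sym2 (Fin 6)))),
      ∀ D ∈ ({octRed, octGreen, octBlue, octYellow} : Set (Set (Sym2 (Fin 6)))),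
        C ≠ D → (SimpleGraph.fromEdgeSet (C ∪ D)).Connected := by
  have red_green : (SimpleGraph.fromEdgeSet (octRed ∪ octGreen)).Connected :=
    SimpleGraph.connected_of_surjective_of_adj_succ ![0, 1, 2, 3, 4, 5] (by decide)
      (by intro i; fin_cases i <;> simp [octRed, octGreen])
  have red_blue : (SimpleGraph.fromEdgeSet (octRed ∪ octBlue)).Connected :=
    SimpleGraph.connected_of_surjective_of_adj_succ ![0, 1, 4, 5, 3, 2] (by decide)
      (by intro i; fin_cases i <;> simp [octRed, octBlue])
  have red_yellow : (SimpleGraph.fromEdgeSet (octRed ∪ octYellow)).Connected :=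
    SimpleGraph.connected_of_surjective_of_adj_succ ![0, 1, 5, 4, 2, 3] (by decide)
      (by intro i; fin_cases i <;> simp [octRed, octYellow])
  have green_blue : (SimpleGraph.fromEdgeSet (octGreen ∪ octBlue)).Connected :=
    SimpleGraph.connected_of_surjective_of_adj_succ ![0, 5, 3, 4, 1, 2] (by decide)
      (by intro i; fin_cases i <;> simp [octGreen, octBlue])
  have green_yellow : (SimpleGraph.fromEdgeSet (octGreen ∪ octYellow)).Connected :=
    SimpleGraph.connected_of_surjective_of_adj_succ ![0, 5, 1, 2, 4, 3] (by decide)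
      (by intro i; fin_cases i <;> simp [octGreen, octYellow])
  have blue_yellow : (SimpleGraph.fromEdgeSet (octBlue ∪ octYellow)).Connected :=
    SimpleGraph.connected_of_surjective_of_adj_succ ![0, 2, 4, 1, 5, 3] (by decide)
      (by intro i; fin_cases i <;> simp [octBlue, octYellow])
  rintro C (rfl | rfl | rfl | rfl) D (rfl | rfl | rfl | rfl) hne
  all_goals first
    | exact absurd rfl hne
    | assumption
    | rw [Set.union_comm]; assumption
end

section
/- Let red = {{1,2},{3,4},{5,6}} and green = {{2,3},{4,5},{6,1}} be the alternating colour classes of the 6-cycle on {1,…,6}. Let M be a perfect matching on {1,…,6} (three pairwise disjoint 2-element subsets covering all six vertices) such that no pair of M lies in red ∪ green, and such that the simple graphs with edge sets red ∪ M and green ∪ M are both connected. Then the simple graph with edge set red ∪ green ∪ M is isomorphic either to the triangular prism graph (the graph consisting of two disjoint triangles joined by a perfect matching) or to the complete bipartite graph K_{3,3}. -/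
/-- The red colour class `{{1,2},{3,4},{5,6}}` of the 6-cycle
(vertices as `Fin 6`, with `i` standing for vertex `i+1`). -/
def cycleRed : Set (Sym2 (Fin 6)) := {s(0, 1), s(2, 3), s(4, 5)}

/-- The green colour class `{{2,3},{4,5},{6,1}}` of the 6-cycle. -/
def cycleGreen : Set (Sym2 (Fin 6)) := {s(1, 2), s(3, 4), s(5, 0)}

/-- The triangular prism graph: two disjoint triangles `{1,2,3}` and `{4,5,6}`
joined by the perfect matching `{{1,6},{3,4},{2,5}}`. -/
def trianglePrismGraph : SimpleGraph (Fin 6) :=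
  SimpleGraph.fromEdgeSet
    {s(0, 1), s(1, 2), s(0, 2), s(3, 4), s(4, 5), s(3, 5), s(0, 5), s(2, 3), s(1, 4)}

theorem fromEdgeSet_cycleRed_union_cycleGreen_adj (v w : Fin 6) :
    (SimpleGraph.fromEdgeSet (cycleRed ∪ cycleGreen)).Adj v w ↔ w = v + 1 ∨ v = w + 1 := by
  simp only [SimpleGraph.fromEdgeSet_adj, cycleRed, cycleGreen, Set.mem_union,
    Set.mem_insert_iff, Set.mem_singleton_iff]
  revert v w
  decide

theorem trianglePrismGraph_adj (v w : Fin 6) :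
    trianglePrismGraph.Adj v w ↔
      s(v, w) ∈ ({s(0, 1), s(1, 2), s(0, 2), s(3, 4), s(4, 5), s(3, 5), s(0, 5), s(2, 3),
        s(1, 4)} : Finset (Sym2 (Fin 6))) ∧ v ≠ w := by
  simp [trianglePrismGraph]

/-- There are four fixed-point-free involutions of the vertices of the 6-cycle that
move no vertex to one of its neighbours. -/
theorem involution_avoiding_cycle (f : Fin 6 → Fin 6) (hf : Function.Involutive f)
    (hne : ∀ v, f v ≠ v) (hsucc : ∀ v, f v ≠ v + 1) :
    f = ![3, 5, 4, 0, 2, 1] ∨ f = ![2, 4, 0, 5, 1, 3] ∨ f = ![4, 3, 5, 1, 0, 2] ∨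
      f = ![3, 4, 5, 0, 1, 2] := by
  have hcand : ∀ v, f v = v + 2 ∨ f v = v + 3 ∨ f v = v + 4 := by
    intro v
    have hpred : f v + 1 ≠ v := fun h => hsucc (f v) ((hf v).trans h.symm)
    have key : ∀ a b : Fin 6, a ≠ b → a ≠ b + 1 → a + 1 ≠ b →
        a = b + 2 ∨ a = b + 3 ∨ a = b + 4 := by decide
    exact key _ _ (hne v) (hsucc v) hpred
  have ext_vec : ∀ a b c d e g : Fin 6, f 0 = a → f 1 = b → f 2 = c → f 3 = d → f 4 = e →
      f 5 = g → f = ![a, b, c, d, e, g] := by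
    rintro _ _ _ _ _ _ rfl rfl rfl rfl rfl rfl
    ext i
    fin_cases i <;> rfl
  have inv : ∀ {v w}, f v = w → f w = v := fun {v w} h => h ▸ hf v
  have h1 := hcand 1
  have h2 := hcand 2
  have h3 := hcand 3
  have h4 := hcand 4
  have h5 := hcand 5
  simp only [Fin.isValue, Fin.reduceAdd] at h1 h2 h3 h4 h5
  rcases hcand 0 with h0 | h0 | h0 <;> simp only [Fin.isValue, Fin.reduceAdd] at h0 <;>
    grind

/-- If a perfect matching `M` (every vertex matched to exactly one other
vertex), edge-disjoint from the red-green 6-cycle, is added to it in such a way that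
both the red–`M` and green–`M` two-colour subgraphs are connected, then the resulting
graph is the triangular prism or `K_{3,3}`: the only rank-3 sextic
maximally-single-trace interactions are the prism and the wheel. -/
theorem rank_three_MST_classification
    (M : SimpleGraph (Fin 6))
    (hmatch : ∀ v : Fin 6, ∃! w : Fin 6, M.Adj v w)
    (hdisj : Disjoint M.edgeSet (cycleRed ∪ cycleGreen))
    (hredM : (SimpleGraph.fromEdgeSet cycleRed ⊔ M).Connected)
    (hgreenM : (SimpleGraph.fromEdgeSet cycleGreen ⊔ M).Connected) :
    Nonempty ((SimpleGraph.fromEdgeSet (cycleRed ∪ cycleGreen) ⊔ M) ≃g trianglePrismGraph)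
    ∨ Nonempty ((SimpleGraph.fromEdgeSet (cycleRed ∪ cycleGreen) ⊔ M)
        ≃g completeBipartiteGraph (Fin 3) (Fin 3)) := by
  choose f hf huniq using hmatch
  have hM : ∀ v w, M.Adj v w ↔ f v = w :=
    fun v w => ⟨fun h => (huniq v w h).symm, fun h => h ▸ hf v⟩
  have hinv : Function.Involutive f := fun v => (hM _ _).1 (hf v).symm
  have hsucc : ∀ v, f v ≠ v + 1 := by
    intro v hv
    have hadj : M.Adj v (v + 1) := (hM _ _).2 hv
    have hcycle := ((fromEdgeSet_cycleRed_union_cycleGreen_adj v (v + 1)).2 (Or.inl rfl))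
    exact Set.disjoint_left.1 hdisj hadj ((SimpleGraph.fromEdgeSet_adj _).1 hcycle).1
  have hG : ∀ v w, (SimpleGraph.fromEdgeSet (cycleRed ∪ cycleGreen) ⊔ M).Adj v w ↔
      (w = v + 1 ∨ v = w + 1) ∨ f v = w := by
    intro v w
    rw [SimpleGraph.sup_adj, fromEdgeSet_cycleRed_union_cycleGreen_adj, hM]
  rcases involution_avoiding_cycle f hinv (fun v => (hf v).ne') hsucc with rfl | rfl | rfl | rfl
  · refine Or.inl ⟨⟨⟨![0, 1, 4, 5, 3, 2], ![0, 1, 5, 4, 2, 3], by decide, by decide⟩, ?_⟩⟩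
    intro v w
    rw [hG, trianglePrismGraph_adj]
    revert v w
    decide
  · refine Or.inl ⟨⟨Equiv.refl _, ?_⟩⟩
    intro v w
    rw [hG, trianglePrismGraph_adj]
    revert v w
    decide
  · refine Or.inl ⟨⟨⟨![5, 0, 1, 2, 3, 4], ![1, 2, 3, 4, 5, 0], by decide, by decide⟩, ?_⟩⟩
    intro v w
    rw [hG, trianglePrismGraph_adj]
    revert v w
    decide
  · refine Or.inr ⟨⟨⟨![.inl 0, .inr 0, .inl 1, .inr 1, .inl 2, .inr 2],
      Sum.elim ![0, 2, 4] ![1, 3, 5], by decide, by decide⟩, ?_⟩⟩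
    intro v w
    rw [hG, completeBipartiteGraph_adj]
    revert v w
    decide
end

section
/- There is no perfect matching on {1,…,6} that is edge-disjoint from the wheel graph; equivalently, the complement of the wheel graph (the simple graph on {1,…,6} with edge set {{1,6},{2,3},{4,5},{1,2},{3,4},{5,6},{1,4},{2,5},{3,6}}) contains no perfect matching. Consequently there is no way to add a fourth colour class to the wheel interaction to obtain a rank-4 maximally-single-trace interaction. -/
/-- The wheel interaction graph on vertices `{1,…,6}` (as `Fin 6`, with `i` standing
for vertex `i+1`): the union of the three perfect matchings
red `{{1,6},{2,3},{4,5}}`, green `{{1,2},{3,4},{5,6}}`, blue `{{1,4},{2,5},{3,6}}`. -/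
def wheelGraph : SimpleGraph (Fin 6) :=
  SimpleGraph.fromEdgeSet
    ({s(0, 5), s(1, 2), s(3, 4)} ∪ {s(0, 1), s(2, 3), s(4, 5)} ∪ {s(0, 3), s(1, 4), s(2, 5)})

theorem wheelGraph_adj_iff (v w : Fin 6) :
    wheelGraph.Adj v w ↔ v.val % 2 ≠ w.val % 2 := by
  simp only [wheelGraph, SimpleGraph.fromEdgeSet_adj, Set.mem_union, Set.mem_insert_iff,
    Set.mem_singleton_iff]
  revert v w
  decide

/-- The wheel graph is complete bipartite with odd parts, so every perfect matching uses one of its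
edges. -/
theorem exists_adj_wheelGraph_adj (M : SimpleGraph (Fin 6)) (hM : ∀ v, ∃! w, M.Adj v w) :
    ∃ v w, M.Adj v w ∧ wheelGraph.Adj v w := by
  by_contra! h
  choose f hf hu using hM
  have inv (v) : f (f v) = v := (hu _ _ (hf v).symm).symm
  have ne (v) : f v ≠ v := (hf v).ne'
  have parity (v) : v.val % 2 = (f v).val % 2 := by
    simpa [wheelGraph_adj_iff] using h v (f v) (hf v)
  have same_part : ∀ v w : Fin 6, v.val % 2 = w.val % 2 → w ≠ v → v.val % 2 = 0 →
      (v = 0 ∧ (w = 2 ∨ w = 4)) ∨ (v = 2 ∧ (w = 0 ∨ w = 4)) ∨ (v = 4 ∧ (w = 0 ∨ w = 2)) := by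
    decide
  have h0 := same_part 0 (f 0) (parity 0) (ne 0) rfl
  have h2 := same_part 2 (f 2) (parity 2) (ne 2) rfl
  have h4 := same_part 4 (f 4) (parity 4) (ne 4) rfl
  have i0 := inv 0
  have i2 := inv 2
  have i4 := inv 4
  grind

/-- There is no perfect matching on `{1,…,6}` edge-disjoint from the wheel
graph; equivalently, the complement of the wheel graph contains no perfect matching.
Hence no fourth colour class can be added to the wheel interaction to obtain a rank-4
maximally-single-trace interaction. -/
theorem no_matching_disjoint_from_wheel :
    (¬ ∃ M : SimpleGraph (Fin 6),
        (∀ v : Fin 6, ∃! w : Fin 6, M.Adj v w) ∧ Disjoint M.edgeSet wheelGraph.edgeSet)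
    ∧ ∀ M : (wheelGraphᶜ).Subgraph, ¬ M.IsPerfectMatching := by
  refine ⟨?_, fun M hM => ?_⟩
  · rintro ⟨M, hM, hdisj⟩
    obtain ⟨v, w, hvw, hwheel⟩ := exists_adj_wheelGraph_adj M hM
    exact Set.disjoint_left.mp hdisj (M.mem_edgeSet.mpr hvw) (wheelGraph.mem_edgeSet.mpr hwheel)
  · obtain ⟨v, w, hvw, hwheel⟩ := exists_adj_wheelGraph_adj M.spanningCoe
      (SimpleGraph.Subgraph.isPerfectMatching_iff.mp hM)
    exact (M.adj_sub hvw).2 hwheel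
end

section
/- Let Y be a perfect matching on {1,…,6} that is edge-disjoint from the prism graph, and suppose that each of the simple graphs with edge sets red ∪ Y, green ∪ Y, and blue ∪ Y is connected, where red = {{1,2},{3,4},{5,6}}, green = {{1,6},{2,3},{4,5}}, blue = {{1,3},{2,5},{4,6}} are the prism's colour classes. Then the simple graph whose edge set is the union of the prism graph's edges with Y is isomorphic to the complete tripartite graph K_{2,2,2} (the octahedron graph). In particular, up to isomorphism there is a unique rank-4 sextic maximally-single-trace interaction, the octahedron. -/
/-- The red colour class `{{1,2},{3,4},{5,6}}` of the prism interaction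
(vertices as `Fin 6`, with `i` standing for vertex `i+1`). -/
def prismRed : Set (Sym2 (Fin 6)) := {s(0, 1), s(2, 3), s(4, 5)}

/-- The green colour class `{{1,6},{2,3},{4,5}}` of the prism interaction. -/
def prismGreen : Set (Sym2 (Fin 6)) := {s(0, 5), s(1, 2), s(3, 4)}

/-- The blue colour class `{{1,3},{2,5},{4,6}}` of the prism interaction. -/
def prismBlue : Set (Sym2 (Fin 6)) := {s(0, 2), s(1, 4), s(3, 5)}

/-- The prism graph: the union of the three colour classes of the prism interaction. -/
def prismGraph : SimpleGraph (Fin 6) :=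
  SimpleGraph.fromEdgeSet (prismRed ∪ prismGreen ∪ prismBlue)

instance : DecidableRel prismGraph.Adj := fun v w =>
  decidable_of_iff
    (s(v, w) ∈ ({s(0, 1), s(2, 3), s(4, 5), s(0, 5), s(1, 2), s(3, 4), s(0, 2), s(1, 4), s(3, 5)} :
      Finset (Sym2 (Fin 6))) ∧ v ≠ w) (by
    simp only [prismGraph, prismRed, prismGreen, prismBlue, SimpleGraph.fromEdgeSet_adj,
      Finset.mem_insert, Finset.mem_singleton, Set.mem_union, Set.mem_insert_iff,
      Set.mem_singleton_iff, or_assoc])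

/-- A graph all of whose vertices have a unique neighbour is described by its partner function. -/
theorem SimpleGraph.exists_partner {V : Type*} {Y : SimpleGraph V}
    (hmatch : ∀ v, ∃! w, Y.Adj v w) : ∃ f : V → V, ∀ v w, Y.Adj v w ↔ f v = w := by
  choose f hf huniq using hmatch
  exact ⟨f, fun v w => ⟨fun h => (huniq v w h).symm, fun h => h ▸ hf v⟩⟩

/-- The complement of the prism is a hexagon, so it has exactly two perfect matchings. -/
theorem prism_partner_eq (f : Fin 6 → Fin 6) (hinv : ∀ v, f (f v) = v) (hne : ∀ v, f v ≠ v)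
    (hdisj : ∀ v, ¬ prismGraph.Adj v (f v)) :
    f = ![3, 5, 4, 0, 2, 1] ∨ f = ![4, 3, 5, 1, 0, 2] := by
  have key : ∀ v w : Fin 6, w ≠ v → ¬ prismGraph.Adj v w →
      w = (![3, 5, 4, 0, 2, 1] : Fin 6 → Fin 6) v ∨
        w = (![4, 3, 5, 1, 0, 2] : Fin 6 → Fin 6) v := by
    decide
  have h v := key v (f v) (hne v) (hdisj v)
  have h0 : f 0 = 3 ∨ f 0 = 4 := h 0
  have h1 : f 1 = 5 ∨ f 1 = 3 := h 1
  have h2 : f 2 = 4 ∨ f 2 = 5 := h 2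
  have h3 : f 3 = 0 ∨ f 3 = 1 := h 3
  have h4 : f 4 = 2 ∨ f 4 = 0 := h 4
  have h5 : f 5 = 1 ∨ f 5 = 2 := h 5
  have i0 := hinv 0
  have i1 := hinv 1
  have i2 := hinv 2
  rcases h0 with h0 | h0 <;> rcases h1 with h1 | h1 <;> rcases h2 with h2 | h2 <;>
    simp_all [funext_iff, Fin.forall_fin_succ]

/-- A bijective labelling of the vertices by parts and indices for which adjacency means lying in
different parts is an isomorphism onto a complete multipartite graph. -/
theorem SimpleGraph.nonempty_iso_completeMultipartiteGraph {V ι : Type*} {α : ι → Type*}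
    {G : SimpleGraph V} (e : V → Σ i, α i) (he : Function.Bijective e)
    (hadj : ∀ v w, G.Adj v w ↔ (e v).1 ≠ (e w).1) :
    Nonempty (G ≃g SimpleGraph.completeMultipartiteGraph α) :=
  ⟨Equiv.ofBijective e he, fun {v w} => (hadj v w).symm⟩

/-- If a perfect matching `Y` (every vertex matched to exactly one other
vertex), edge-disjoint from the prism graph, is added so that each of the red–`Y`,
green–`Y` and blue–`Y` two-colour subgraphs is connected, then the resulting graph is
isomorphic to the complete tripartite graph `K_{2,2,2}` (the octahedron): up to
isomorphism there is a unique rank-4 sextic maximally-single-trace interaction. -/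
theorem rank_four_MST_classification
    (Y : SimpleGraph (Fin 6))
    (hmatch : ∀ v : Fin 6, ∃! w : Fin 6, Y.Adj v w)
    (hdisj : Disjoint Y.edgeSet prismGraph.edgeSet)
    (hredY : (SimpleGraph.fromEdgeSet prismRed ⊔ Y).Connected)
    (hgreenY : (SimpleGraph.fromEdgeSet prismGreen ⊔ Y).Connected)
    (hblueY : (SimpleGraph.fromEdgeSet prismBlue ⊔ Y).Connected) :
    Nonempty ((prismGraph ⊔ Y)
      ≃g SimpleGraph.completeMultipartiteGraph (fun _ : Fin 3 => Fin 2)) := by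
  obtain ⟨f, hf⟩ := SimpleGraph.exists_partner hmatch
  have hY v : Y.Adj v (f v) := (hf v _).2 rfl
  have hprism v : ¬ prismGraph.Adj v (f v) :=
    fun h => (SimpleGraph.disjoint_edgeSet.1 hdisj).le_bot
      (show (Y ⊓ prismGraph).Adj v (f v) from ⟨hY v, h⟩)
  rcases prism_partner_eq f (fun v => (hf _ _).1 (hY v).symm) (fun v => (hY v).ne') hprism
    with rfl | rfl
  · apply SimpleGraph.nonempty_iso_completeMultipartiteGraph
      (fun v => ⟨![0, 1, 2, 1, 0, 2] v, ![0, 0, 0, 1, 1, 1] v⟩) (by decide)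
    simp only [SimpleGraph.sup_adj, hf]
    decide
  · apply SimpleGraph.nonempty_iso_completeMultipartiteGraph
      (fun v => ⟨![0, 1, 2, 0, 2, 1] v, ![0, 0, 0, 1, 1, 1] v⟩) (by decide)
    simp only [SimpleGraph.sup_adj, hf]
    decide
end

section
/- The set of permutations σ of {1,…,6} that map each of the three colour classes of the prism interaction graph to itself (i.e., σ sends red edges to red edges, green to green, and blue to blue) is exactly { id, (1 6)(2 5)(3 4) }. In particular this colour-preserving automorphism group has order 2, and its nontrivial element is an odd permutation. -/
/-- The permutation `(1 6)(2 5)(3 4)` of the vertices `{1,…,6}` (in `Fin 6`: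
`(0 5)(1 4)(2 3)`). -/
def prismFlip : Equiv.Perm (Fin 6) :=
  Equiv.swap 0 5 * Equiv.swap 1 4 * Equiv.swap 2 3

set_option synthInstance.maxSize 1000 in
/-- An edge-preserving labelling of the vertices `0, …, 5` of the prism is the identity or the
reversal. -/
theorem prism_labelling_eq : ∀ a b : Fin 6,
    s(a, b) ∈ ({s(0, 1), s(2, 3), s(4, 5)} : Finset (Sym2 (Fin 6))) →
    ∀ c, s(b, c) ∈ ({s(0, 5), s(1, 2), s(3, 4)} : Finset (Sym2 (Fin 6))) →
    s(a, c) ∈ ({s(0, 2), s(1, 4), s(3, 5)} : Finset (Sym2 (Fin 6))) →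
    ∀ d, s(c, d) ∈ ({s(0, 1), s(2, 3), s(4, 5)} : Finset (Sym2 (Fin 6))) →
    ∀ e, s(d, e) ∈ ({s(0, 5), s(1, 2), s(3, 4)} : Finset (Sym2 (Fin 6))) →
    ∀ f, s(e, f) ∈ ({s(0, 1), s(2, 3), s(4, 5)} : Finset (Sym2 (Fin 6))) →
      (a = 0 ∧ b = 1 ∧ c = 2 ∧ d = 3 ∧ e = 4 ∧ f = 5) ∨
        (a = 5 ∧ b = 4 ∧ c = 3 ∧ d = 2 ∧ e = 1 ∧ f = 0) := by
  decide

/-- A permutation preserves the three colour classes, written as finite sets of pairs, if and only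
if it is the identity or the flip. -/
theorem prism_image_eq_iff (σ : Equiv.Perm (Fin 6)) :
    (Finset.image (Sym2.map σ) {s(0, 1), s(2, 3), s(4, 5)} = {s(0, 1), s(2, 3), s(4, 5)} ∧
      Finset.image (Sym2.map σ) {s(0, 5), s(1, 2), s(3, 4)} = {s(0, 5), s(1, 2), s(3, 4)} ∧
        Finset.image (Sym2.map σ) {s(0, 2), s(1, 4), s(3, 5)} = {s(0, 2), s(1, 4), s(3, 5)}) ↔
      σ = 1 ∨ σ = prismFlip := by
  constructor
  · rintro ⟨hr, hg, hb⟩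
    have mapsTo {C : Finset (Sym2 (Fin 6))} (h : C.image (Sym2.map σ) = C) (x y : Fin 6)
        (hxy : s(x, y) ∈ C) : s(σ x, σ y) ∈ C := h ▸ Finset.mem_image_of_mem (Sym2.map σ) hxy
    refine (prism_labelling_eq (σ 0) (σ 1) (mapsTo hr 0 1 (by decide))
      (σ 2) (mapsTo hg 1 2 (by decide)) (mapsTo hb 0 2 (by decide))
      (σ 3) (mapsTo hr 2 3 (by decide)) (σ 4) (mapsTo hg 3 4 (by decide))
      (σ 5) (mapsTo hr 4 5 (by decide))).imp ?_ ?_ <;>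
    · rintro ⟨h0, h1, h2, h3, h4, h5⟩
      ext x : 1
      fin_cases x
      exacts [h0, h1, h2, h3, h4, h5]
  · rintro (rfl | rfl) <;> decide

/-- The colour-preserving automorphisms of the prism interaction are
exactly the identity and `(1 6)(2 5)(3 4)`; the latter is an odd permutation. -/
theorem prism_colour_preserving_automorphisms :
    {σ : Equiv.Perm (Fin 6) |
        Sym2.map σ '' prismRed = prismRed ∧ Sym2.map σ '' prismGreen = prismGreen ∧
          Sym2.map σ '' prismBlue = prismBlue}
      = {1, prismFlip}
    ∧ Equiv.Perm.sign prismFlip = -1 := by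
  refine ⟨?_, by decide⟩
  ext σ
  rw [Set.mem_ofPred_eq, Set.mem_insert_iff, Set.mem_singleton_iff, ← prism_image_eq_iff σ]
  simp only [prismRed, prismGreen, prismBlue, ← Finset.coe_inj, Finset.coe_image,
    Finset.coe_insert, Finset.coe_singleton]
end

section
/- The group of permutations σ of {1,…,6} that map each of the three colour classes of the wheel interaction graph to itself (σ sends red edges to red edges, green to green, and blue to blue) has exactly 6 elements, namely { id, (1 3 5)(2 4 6), (1 5 3)(2 6 4), (1 6)(2 5)(3 4), (1 2)(3 6)(4 5), (1 4)(2 3)(5 6) }. In particular it contains odd permutations. -/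
/-- The red colour class `{{1,6},{2,3},{4,5}}` of the wheel interaction
(vertices as `Fin 6`, with `i` standing for vertex `i+1`). -/
def wheelRed : Set (Sym2 (Fin 6)) := {s(0, 5), s(1, 2), s(3, 4)}

/-- The green colour class `{{1,2},{3,4},{5,6}}` of the wheel interaction. -/
def wheelGreen : Set (Sym2 (Fin 6)) := {s(0, 1), s(2, 3), s(4, 5)}

/-- The blue colour class `{{1,4},{2,5},{3,6}}` of the wheel interaction. -/
def wheelBlue : Set (Sym2 (Fin 6)) := {s(0, 3), s(1, 4), s(2, 5)}

/-- `(1 3 5)(2 4 6)`, i.e. `(0 2 4)(1 3 5)` on `Fin 6`. -/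
def wheelAut₁ : Equiv.Perm (Fin 6) :=
  Equiv.swap 0 2 * Equiv.swap 2 4 * (Equiv.swap 1 3 * Equiv.swap 3 5)

/-- `(1 5 3)(2 6 4)`, i.e. `(0 4 2)(1 5 3)` on `Fin 6`. -/
def wheelAut₂ : Equiv.Perm (Fin 6) :=
  Equiv.swap 0 4 * Equiv.swap 4 2 * (Equiv.swap 1 5 * Equiv.swap 5 3)

/-- `(1 6)(2 5)(3 4)`, i.e. `(0 5)(1 4)(2 3)` on `Fin 6`. -/
def wheelAut₃ : Equiv.Perm (Fin 6) :=
  Equiv.swap 0 5 * Equiv.swap 1 4 * Equiv.swap 2 3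

/-- `(1 2)(3 6)(4 5)`, i.e. `(0 1)(2 5)(3 4)` on `Fin 6`. -/
def wheelAut₄ : Equiv.Perm (Fin 6) :=
  Equiv.swap 0 1 * Equiv.swap 2 5 * Equiv.swap 3 4

/-- `(1 4)(2 3)(5 6)`, i.e. `(0 3)(1 2)(4 5)` on `Fin 6`. -/
def wheelAut₅ : Equiv.Perm (Fin 6) :=
  Equiv.swap 0 3 * Equiv.swap 1 2 * Equiv.swap 4 5

/-- A permutation preserves the perfect matching `{s(x, r x)}` of an involution `r`
exactly when it commutes with `r`. -/
theorem Sym2.image_map_eq_self_iff_forall_comm {α : Type*} {r : α → α}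
    (hr : Function.Involutive r) {S : Set (Sym2 α)}
    (hS : ∀ x y, s(x, y) ∈ S ↔ y = r x) (σ : Equiv.Perm α) :
    Sym2.map σ '' S = S ↔ ∀ x, σ (r x) = r (σ x) := by
  constructor
  · intro h x
    rw [← hS, ← h]
    exact ⟨s(x, r x), (hS _ _).2 rfl, Sym2.map_mk ..⟩
  · intro h
    ext e
    induction e using Sym2.ind with
    | _ a b =>
      rw [hS]
      constructor
      · rintro ⟨e, he, hab⟩
        induction e using Sym2.ind with
        | _ x y =>
          rw [hS] at he
          subst he
          rw [Sym2.map_mk, h, Sym2.eq_iff] at hab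
          rcases hab with ⟨rfl, rfl⟩ | ⟨rfl, rfl⟩
          · rfl
          · exact (hr _).symm
      · rintro rfl
        refine ⟨s(σ.symm a, r (σ.symm a)), (hS _ _).2 rfl, ?_⟩
        rw [Sym2.map_mk, h, σ.apply_symm_apply]

/-- The vertex joined to a given vertex by a red edge. -/
def wheelRedPartner : Fin 6 → Fin 6 := ![5, 2, 1, 4, 3, 0]

theorem image_map_wheelRed_eq_self_iff (σ : Equiv.Perm (Fin 6)) :
    Sym2.map σ '' wheelRed = wheelRed ↔
      ∀ x, σ (wheelRedPartner x) = wheelRedPartner (σ x) := by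
  refine Sym2.image_map_eq_self_iff_forall_comm (by unfold Function.Involutive; decide) ?_ σ
  simp only [wheelRed, Set.mem_insert_iff, Set.mem_singleton_iff]
  decide

/-- The vertex joined to a given vertex by a green edge. -/
def wheelGreenPartner : Fin 6 → Fin 6 := ![1, 0, 3, 2, 5, 4]

theorem image_map_wheelGreen_eq_self_iff (σ : Equiv.Perm (Fin 6)) :
    Sym2.map σ '' wheelGreen = wheelGreen ↔
      ∀ x, σ (wheelGreenPartner x) = wheelGreenPartner (σ x) := by
  refine Sym2.image_map_eq_self_iff_forall_comm (by unfold Function.Involutive; decide) ?_ σ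
  simp only [wheelGreen, Set.mem_insert_iff, Set.mem_singleton_iff]
  decide

/-- The vertex joined to a given vertex by a blue edge. -/
def wheelBluePartner : Fin 6 → Fin 6 := ![3, 4, 5, 0, 1, 2]

theorem image_map_wheelBlue_eq_self_iff (σ : Equiv.Perm (Fin 6)) :
    Sym2.map σ '' wheelBlue = wheelBlue ↔
      ∀ x, σ (wheelBluePartner x) = wheelBluePartner (σ x) := by
  refine Sym2.image_map_eq_self_iff_forall_comm (by unfold Function.Involutive; decide) ?_ σ
  simp only [wheelBlue, Set.mem_insert_iff, Set.mem_singleton_iff]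
  decide

/-- The colour-preserving automorphisms of the wheel interaction form a
group of exactly 6 elements, and this group contains odd permutations. -/
theorem wheel_colour_preserving_automorphisms :
    {σ : Equiv.Perm (Fin 6) |
        Sym2.map σ '' wheelRed = wheelRed ∧ Sym2.map σ '' wheelGreen = wheelGreen ∧
          Sym2.map σ '' wheelBlue = wheelBlue}
      = {1, wheelAut₁, wheelAut₂, wheelAut₃, wheelAut₄, wheelAut₅}
    ∧ ∃ σ ∈ {σ : Equiv.Perm (Fin 6) |
        Sym2.map σ '' wheelRed = wheelRed ∧ Sym2.map σ '' wheelGreen = wheelGreen ∧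
          Sym2.map σ '' wheelBlue = wheelBlue},
        Equiv.Perm.sign σ = -1 := by
  simp only [image_map_wheelRed_eq_self_iff, image_map_wheelGreen_eq_self_iff,
    image_map_wheelBlue_eq_self_iff]
  refine ⟨?_, wheelAut₃, by simp only [Set.mem_ofPred_eq]; decide, by decide⟩
  ext σ
  simp only [Set.mem_ofPred_eq, Set.mem_insert_iff, Set.mem_singleton_iff]
  constructor
  · rintro ⟨hr, hg, hb⟩
    have eq_of_apply_zero (τ : Equiv.Perm (Fin 6)) (h0 : σ 0 = τ 0)
        (htr : ∀ x, τ (wheelRedPartner x) = wheelRedPartner (τ x))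
        (htg : ∀ x, τ (wheelGreenPartner x) = wheelGreenPartner (τ x))
        (htb : ∀ x, τ (wheelBluePartner x) = wheelBluePartner (τ x)) :
        σ = τ := by
      have h5 : σ 5 = τ 5 := (hr 0).trans (h0 ▸ (htr 0).symm)
      have h1 : σ 1 = τ 1 := (hg 0).trans (h0 ▸ (htg 0).symm)
      have h3 : σ 3 = τ 3 := (hb 0).trans (h0 ▸ (htb 0).symm)
      have h2 : σ 2 = τ 2 := (hr 1).trans (h1 ▸ (htr 1).symm)
      have h4 : σ 4 = τ 4 := (hr 3).trans (h3 ▸ (htr 3).symm)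
      ext x
      fin_cases x <;> simp [*]
    have h : σ 0 = 0 ∨ σ 0 = 2 ∨ σ 0 = 4 ∨ σ 0 = 5 ∨ σ 0 = 1 ∨ σ 0 = 3 := by
      generalize σ 0 = y
      revert y
      decide
    refine h.imp ?_ (Or.imp ?_ (Or.imp ?_ (Or.imp ?_ (Or.imp ?_ ?_)))) <;>
      exact fun h ↦ eq_of_apply_zero _ h (by decide) (by decide) (by decide)
  · rintro (rfl | rfl | rfl | rfl | rfl | rfl) <;> decide
end

section
/- The only permutation σ of {1,…,6} that maps each of the four colour classes of the octahedron interaction graph to itself (σ sends red edges to red edges, green to green, blue to blue, and yellow to yellow) is the identity; i.e., the colour-preserving automorphism group of the octahedron interaction is trivial. -/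
/-- If `C` is the perfect matching pairing each `x` with `f x`, then a map sending `C` onto itself
commutes with `f`. -/
theorem map_partner_of_image_eq {α : Type*} {f σ : α → α} {C : Set (Sym2 α)}
    (hC : ∀ x y, s(x, y) ∈ C ↔ f x = y) (h : Sym2.map σ '' C = C) (x : α) :
    σ (f x) = f (σ x) := by
  have hx : Sym2.map σ s(x, f x) ∈ Sym2.map σ '' C :=
    Set.mem_image_of_mem _ ((hC x (f x)).2 rfl)
  rw [h, Sym2.map_mk] at hx
  exact ((hC _ _).1 hx).symm

/-- The red partner of a vertex. -/
def redPartner : Fin 6 → Fin 6 := ![1, 0, 3, 2, 5, 4]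

/-- The green partner of a vertex. -/
def greenPartner : Fin 6 → Fin 6 := ![5, 2, 1, 4, 3, 0]

/-- The blue partner of a vertex. -/
def bluePartner : Fin 6 → Fin 6 := ![2, 4, 0, 5, 1, 3]

/-- The yellow partner of a vertex. -/
def yellowPartner : Fin 6 → Fin 6 := ![3, 5, 4, 0, 2, 1]

theorem mem_octRed_iff (x y : Fin 6) : s(x, y) ∈ octRed ↔ redPartner x = y := by
  simp only [octRed, Set.mem_insert_iff, Set.mem_singleton_iff]
  revert x y
  decide

theorem mem_octGreen_iff (x y : Fin 6) : s(x, y) ∈ octGreen ↔ greenPartner x = y := by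
  simp only [octGreen, Set.mem_insert_iff, Set.mem_singleton_iff]
  revert x y
  decide

theorem mem_octBlue_iff (x y : Fin 6) : s(x, y) ∈ octBlue ↔ bluePartner x = y := by
  simp only [octBlue, Set.mem_insert_iff, Set.mem_singleton_iff]
  revert x y
  decide

theorem mem_octYellow_iff (x y : Fin 6) : s(x, y) ∈ octYellow ↔ yellowPartner x = y := by
  simp only [octYellow, Set.mem_insert_iff, Set.mem_singleton_iff]
  revert x y
  decide

/-- Vertex `0` is the only one from which the four two-colour paths red-green, green-yellow,
blue-red and yellow-blue lead to a common vertex. -/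
theorem eq_zero_of_partner_eq (k : Fin 6)
    (h₁ : redPartner (greenPartner k) = greenPartner (yellowPartner k))
    (h₂ : greenPartner (yellowPartner k) = bluePartner (redPartner k))
    (h₃ : bluePartner (redPartner k) = yellowPartner (bluePartner k)) : k = 0 := by
  revert k
  decide

/-- The only permutation of `{1,…,6}` preserving each of the four colour
classes of the octahedron interaction is the identity: the colour-preserving
automorphism group of the octahedron interaction is trivial. -/
theorem octahedron_colour_preserving_automorphisms_trivial
    (σ : Equiv.Perm (Fin 6))
    (hred : Sym2.map σ '' octRed = octRed)
    (hgreen : Sym2.map σ '' octGreen = octGreen)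
    (hblue : Sym2.map σ '' octBlue = octBlue)
    (hyellow : Sym2.map σ '' octYellow = octYellow) :
    σ = 1 := by
  have hr := map_partner_of_image_eq mem_octRed_iff hred
  have hg := map_partner_of_image_eq mem_octGreen_iff hgreen
  have hb := map_partner_of_image_eq mem_octBlue_iff hblue
  have hy := map_partner_of_image_eq mem_octYellow_iff hyellow
  have h1 : σ 1 = redPartner (σ 0) := hr 0
  have h2 : σ 2 = bluePartner (σ 0) := hb 0
  have h3 : σ 3 = yellowPartner (σ 0) := hy 0
  have h5 : σ 5 = greenPartner (σ 0) := hg 0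
  have h4r : σ 4 = redPartner (greenPartner (σ 0)) := h5 ▸ hr 5
  have h4g : σ 4 = greenPartner (yellowPartner (σ 0)) := h3 ▸ hg 3
  have h4b : σ 4 = bluePartner (redPartner (σ 0)) := h1 ▸ hb 1
  have h4y : σ 4 = yellowPartner (bluePartner (σ 0)) := h2 ▸ hy 2
  have h0 : σ 0 = 0 :=
    eq_zero_of_partner_eq (σ 0) (h4r.symm.trans h4g) (h4g.symm.trans h4b) (h4b.symm.trans h4y)
  rw [h0] at h1 h2 h3 h4r h5
  ext i
  fin_cases i
  exacts [congrArg Fin.val h0, congrArg Fin.val h1, congrArg Fin.val h2, congrArg Fin.val h3,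
    congrArg Fin.val h4r, congrArg Fin.val h5]
end

section
/- The octahedron interaction is symmetric under all permutations of its four colours: for every permutation π of the four colour classes {red, green, blue, yellow} of the octahedron interaction graph, there exists a permutation σ of {1,…,6} such that, for each colour c, σ maps the colour class c onto the colour class π(c). -/
/-- The four colour classes of the octahedron interaction, indexed by `Fin 4`
(`0` = red `{{1,2},{3,4},{5,6}}`, `1` = green `{{1,6},{2,3},{4,5}}`,
`2` = blue `{{1,3},{2,5},{4,6}}`, `3` = yellow `{{1,4},{2,6},{3,5}}`;
vertices as `Fin 6`, with `i` standing for vertex `i+1`). -/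
def octClasses : Fin 4 → Set (Sym2 (Fin 6)) :=
  ![{s(0, 1), s(2, 3), s(4, 5)}, {s(0, 5), s(1, 2), s(3, 4)},
    {s(0, 2), s(1, 4), s(3, 5)}, {s(0, 3), s(1, 5), s(2, 4)}]

/-- The colour classes as finsets, for which equality is decidable. -/
def octClassesFinset : Fin 4 → Finset (Sym2 (Fin 6)) :=
  ![{s(0, 1), s(2, 3), s(4, 5)}, {s(0, 5), s(1, 2), s(3, 4)},
    {s(0, 2), s(1, 4), s(3, 5)}, {s(0, 3), s(1, 5), s(2, 4)}]

theorem coe_octClassesFinset (c : Fin 4) : (octClassesFinset c : Set _) = octClasses c := by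
  fin_cases c <;> simp [octClassesFinset, octClasses]

/-- The vertex permutations realizing the adjacent colour transpositions. -/
def octAdjacentSwap : Fin 3 → Equiv.Perm (Fin 6) :=
  ![Equiv.swap 0 3 * Equiv.swap 1 4 * Equiv.swap 2 5,
    Equiv.swap 0 4 * Equiv.swap 1 5 * Equiv.swap 2 3,
    Equiv.swap 0 1 * Equiv.swap 2 5 * Equiv.swap 3 4]

theorem image_octClassesFinset_octAdjacentSwap (i : Fin 3) (c : Fin 4) :
    (octClassesFinset c).image (Sym2.map (octAdjacentSwap i)) =
      octClassesFinset (Equiv.swap i.castSucc i.succ c) := by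
  revert i c
  decide

theorem image_octClasses_octAdjacentSwap (i : Fin 3) (c : Fin 4) :
    Sym2.map (octAdjacentSwap i) '' octClasses c =
      octClasses (Equiv.swap i.castSucc i.succ c) := by
  rw [← coe_octClassesFinset, ← coe_octClassesFinset, ← Finset.coe_image,
    image_octClassesFinset_octAdjacentSwap]

/-- The octahedron interaction is symmetric under all permutations of
its four colours: every permutation of the colour classes is realized by a
permutation of the six field-vertices. -/
theorem octahedron_colour_permutation_symmetry (π : Equiv.Perm (Fin 4)) :
    ∃ σ : Equiv.Perm (Fin 6), ∀ c : Fin 4,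
      Sym2.map σ '' octClasses c = octClasses (π c) := by
  have hπ : π ∈ Submonoid.closure
      (Set.range fun i : Fin 3 ↦ Equiv.swap i.castSucc i.succ) := by
    rw [Equiv.Perm.mclosure_swap_castSucc_succ]
    exact Submonoid.mem_top π
  induction hπ using Submonoid.closure_induction with
  | mem _ h =>
    obtain ⟨i, rfl⟩ := h
    exact ⟨octAdjacentSwap i, image_octClasses_octAdjacentSwap i⟩
  | one => exact ⟨1, fun c ↦ by simp⟩
  | mul π₁ π₂ _ _ h₁ h₂ =>
    obtain ⟨σ₁, h₁⟩ := h₁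
    obtain ⟨σ₂, h₂⟩ := h₂
    refine ⟨σ₁ * σ₂, fun c ↦ ?_⟩
    rw [Equiv.Perm.coe_mul, Sym2.map_comp, Set.image_comp, h₂, h₁, Equiv.Perm.mul_apply]
end

section
/- For every n : ℕ, every real vector space (or ℝ-module) V, and every function ψ : Fin n → Fin n → Fin n → V, the following element of the exterior algebra Λ(V) over ℝ vanishes: ∑_{a₁,a₂,a₃,b₁,b₂,b₃,c₁,c₂,c₃ : Fin n} ι(ψ a₁ b₁ c₁) * ι(ψ a₁ b₂ c₂) * ι(ψ a₂ b₂ c₃) * ι(ψ a₂ b₃ c₁) * ι(ψ a₃ b₃ c₂) * ι(ψ a₃ b₁ c₃) = 0, where ι : V → Λ(V) is the canonical inclusion and * is the exterior (wedge) product. -/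
open ExteriorAlgebra

/-- Reversing the order of a product of six degree-one elements is an odd operation. -/
theorem ExteriorAlgebra.ι_mul_reverse_six {R M : Type*} [CommRing R] [AddCommGroup M] [Module R M]
    (u v w x y z : M) :
    ι R z * ι R y * ι R x * ι R w * ι R v * ι R u =
      -(ι R u * ι R v * ι R w * ι R x * ι R y * ι R z) := by
  have h := (ιMulti R 6).map_perm ![u, v, w, x, y, z] Fin.revPerm
  have hsign : Equiv.Perm.sign (Fin.revPerm : Equiv.Perm (Fin 6)) = -1 := by decide
  have hrev : ![u, v, w, x, y, z] ∘ (Fin.revPerm : Equiv.Perm (Fin 6)) = ![z, y, x, w, v, u] := by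
    ext i
    fin_cases i <;> rfl
  rw [hsign, hrev, Units.neg_smul, one_smul] at h
  simpa [ιMulti_apply, mul_assoc] using h

theorem Fintype.sum_sum_sum_swap_outer {α M : Type*} [Fintype α] [AddCommMonoid M]
    (f : α → α → α → M) :
    ∑ x, ∑ y, ∑ z, f x y z = ∑ x, ∑ y, ∑ z, f z y x :=
  calc
    _ = ∑ y, ∑ x, ∑ z, f x y z := Finset.sum_comm
    _ = ∑ y, ∑ x, ∑ z, f z y x := Finset.sum_congr rfl fun _ _ => Finset.sum_comm
    _ = _ := Finset.sum_comm

/-- The wheel (`K_{3,3}`) interaction of a single real (Majorana)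
fermionic rank-3 tensor vanishes identically in the exterior (Grassmann) algebra. -/
theorem wheel_interaction_vanishes_for_majorana
    (n : ℕ) (V : Type*) [AddCommGroup V] [Module ℝ V]
    (ψ : Fin n → Fin n → Fin n → V) :
    ∑ a₁ : Fin n, ∑ a₂ : Fin n, ∑ a₃ : Fin n,
      ∑ b₁ : Fin n, ∑ b₂ : Fin n, ∑ b₃ : Fin n,
        ∑ c₁ : Fin n, ∑ c₂ : Fin n, ∑ c₃ : Fin n,
          ι ℝ (ψ a₁ b₁ c₁) * ι ℝ (ψ a₁ b₂ c₂) * ι ℝ (ψ a₂ b₂ c₃) *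
            ι ℝ (ψ a₂ b₃ c₁) * ι ℝ (ψ a₃ b₃ c₂) * ι ℝ (ψ a₃ b₁ c₃)
      = (0 : ExteriorAlgebra ℝ V) := by
  have : IsAddTorsionFree (ExteriorAlgebra ℝ V) := .of_isTorsionFree ℝ _
  refine self_eq_neg.mp ?_
  conv_lhs => rw [Fintype.sum_sum_sum_swap_outer]
  simp only [← Finset.sum_neg_distrib]
  refine Fintype.sum_congr _ _ fun a₁ => Fintype.sum_congr _ _ fun a₂ =>
    Fintype.sum_congr _ _ fun a₃ => Fintype.sum_congr _ _ fun b₁ => ?_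
  rw [Finset.sum_comm]
  refine Fintype.sum_congr _ _ fun b₂ => Fintype.sum_congr _ _ fun b₃ => ?_
  rw [Fintype.sum_sum_sum_swap_outer]
  exact Fintype.sum_congr _ _ fun c₁ => Fintype.sum_congr _ _ fun c₂ =>
    Fintype.sum_congr _ _ fun c₃ => ι_mul_reverse_six _ _ _ _ _ _
end

section
/- In the symmetric group on the 12 letters {1_L,…,6_L, 1_R,…,6_R}, let G be the subgroup generated by the six permutations σ_rg = (1_L 5_L)(2_L 4_L)(1_R 5_R)(2_R 4_R), σ_gb = (1_L 5_L)(4_L 6_L)(1_R 5_R)(4_R 6_R), a_L = (1_L 6_L)(2_L 5_L)(3_L 4_L), a'_L = (1_L 2_L)(4_L 5_L)(3_L 6_L), a_R = (1_R 6_R)(2_R 5_R)(3_R 4_R), a'_R = (1_R 2_R)(4_R 5_R)(3_R 6_R). Then: (i) G has exactly 216 elements; (ii) the G-orbit of 1_L is {1_L,…,6_L}; (iii) the stabilizer of 1_L in G has exactly 36 elements, and its orbit of 1_R is {1_R,…,6_R}; (iv) the simultaneous stabilizer of 1_L and 1_R in G has exactly 6 elements, and its orbits on {2_L,…,6_L}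 are {2_L, 4_L, 6_L} and {3_L, 5_L}. -/
/- The 12 letters {1_L,…,6_L, 1_R,…,6_R} are identified with `Fin 12` via
`i_L ↦ i - 1` and `i_R ↦ i + 5`. -/

/-- `σ_rg = (1_L 5_L)(2_L 4_L)(1_R 5_R)(2_R 4_R)`. -/
def sigmaRG : Equiv.Perm (Fin 12) :=
  Equiv.swap 0 4 * Equiv.swap 1 3 * Equiv.swap 6 10 * Equiv.swap 7 9

/-- `σ_gb = (1_L 5_L)(4_L 6_L)(1_R 5_R)(4_R 6_R)`. -/
def sigmaGB : Equiv.Perm (Fin 12) :=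
  Equiv.swap 0 4 * Equiv.swap 3 5 * Equiv.swap 6 10 * Equiv.swap 9 11

/-- `a_L = (1_L 6_L)(2_L 5_L)(3_L 4_L)`. -/
def autL : Equiv.Perm (Fin 12) :=
  Equiv.swap 0 5 * Equiv.swap 1 4 * Equiv.swap 2 3

/-- `a'_L = (1_L 2_L)(4_L 5_L)(3_L 6_L)`. -/
def autL' : Equiv.Perm (Fin 12) :=
  Equiv.swap 0 1 * Equiv.swap 3 4 * Equiv.swap 2 5

/-- `a_R = (1_R 6_R)(2_R 5_R)(3_R 4_R)`. -/
def autR : Equiv.Perm (Fin 12) :=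
  Equiv.swap 6 11 * Equiv.swap 7 10 * Equiv.swap 8 9

/-- `a'_R = (1_R 2_R)(4_R 5_R)(3_R 6_R)`. -/
def autR' : Equiv.Perm (Fin 12) :=
  Equiv.swap 6 7 * Equiv.swap 9 10 * Equiv.swap 8 11

/-- The combined colour-permutation and automorphism symmetry group for two wheel
(`K_{3,3}`) interaction vertices `L` and `R`. -/
def wheelPairGroup : Subgroup (Equiv.Perm (Fin 12)) :=
  Subgroup.closure {sigmaRG, sigmaGB, autL, autL', autR, autR'}

/-- The elements of a group generated by two involutions satisfying the braid relation, as words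
in these involutions. -/
def braidWord {H : Type*} [Group H] (a b : H) : Fin 6 → H :=
  ![1, a, b, a * b, b * a, a * b * a]

theorem exists_mul_braidWord {H : Type*} [Group H] {a b : H} (ha : a * a = 1) (hb : b * b = 1)
    (hab : a * b * a = b * a * b) (i : Fin 6) :
    (∃ j, a * braidWord a b i = braidWord a b j) ∧
      ∃ j, b * braidWord a b i = braidWord a b j := by
  have ha' (x : H) : a * (a * x) = x := by rw [← mul_assoc, ha, one_mul]
  have hb' (x : H) : b * (b * x) = x := by rw [← mul_assoc, hb, one_mul]
  simp only [mul_assoc] at hab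
  constructor
  · refine ⟨![1, 0, 3, 2, 5, 4] i, ?_⟩
    fin_cases i <;> simp [braidWord, mul_assoc, ha, ha']
  · refine ⟨![2, 4, 0, 5, 1, 3] i, ?_⟩
    fin_cases i <;> simp [braidWord, mul_assoc, hb, hb', hab]

theorem braidWord_mem {H : Type*} [Group H] {a b : H} {K : Subgroup H} (ha : a ∈ K) (hb : b ∈ K)
    (i : Fin 6) : braidWord a b i ∈ K := by
  have hab := K.mul_mem ha hb
  have hba := K.mul_mem hb ha
  have haba := K.mul_mem hab ha
  fin_cases i <;> simp [braidWord, *]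

/-- Normal form of the elements of `wheelPairGroup`: an automorphism of the left vertex, an
automorphism of the right vertex and a colour permutation. -/
def wheelWord (p : Fin 6 × Fin 6 × Fin 6) : Equiv.Perm (Fin 12) :=
  braidWord autL autL' p.1 * (braidWord autR autR' p.2.1 * braidWord sigmaRG sigmaGB p.2.2)

theorem wheelWord_injective : Function.Injective wheelWord := by
  have hσ : ∀ k, braidWord sigmaRG sigmaGB k 2 = 2 ∧ braidWord sigmaRG sigmaGB k 8 = 8 := by
    decide
  have hL : ∀ i i' j j', braidWord autL autL' i (braidWord autR autR' j 2) =
      braidWord autL autL' i' (braidWord autR autR' j' 2) → i = i' := by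
    decide +kernel
  have hR : ∀ i i' j j', braidWord autL autL' i (braidWord autR autR' j 8) =
      braidWord autL autL' i' (braidWord autR autR' j' 8) → j = j' := by
    decide +kernel
  have hinj : Function.Injective (braidWord sigmaRG sigmaGB) := by decide
  rintro ⟨i, j, k⟩ ⟨i', j', k'⟩ h
  have h2 := DFunLike.congr_fun h 2
  have h8 := DFunLike.congr_fun h 8
  simp only [wheelWord, Equiv.Perm.mul_apply, hσ] at h2 h8
  obtain rfl := hL _ _ _ _ h2
  obtain rfl := hR _ _ _ _ h8
  obtain rfl := hinj (mul_left_cancel (mul_left_cancel h))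
  rfl

theorem exists_mul_wheelWord {g : Equiv.Perm (Fin 12)}
    (hg : g ∈ ({sigmaRG, sigmaGB, autL, autL', autR, autR'} : Set (Equiv.Perm (Fin 12))))
    (p : Fin 6 × Fin 6 × Fin 6) : ∃ q, g * wheelWord p = wheelWord q := by
  obtain ⟨i, j, k⟩ := p
  have hL := exists_mul_braidWord (a := autL) (b := autL') (by decide) (by decide) (by decide) i
  have hR := exists_mul_braidWord (a := autR) (b := autR') (by decide) (by decide) (by decide) j
  have hσ := exists_mul_braidWord (a := sigmaRG) (b := sigmaGB) (by decide) (by decide)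
    (by decide) k
  have of_color {s : Equiv.Perm (Fin 12)}
      (sL : ∀ i, ∃ i', s * braidWord autL autL' i = braidWord autL autL' i' * s)
      (sR : ∀ j, ∃ j', s * braidWord autR autR' j = braidWord autR autR' j' * s)
      (sσ : ∃ k', s * braidWord sigmaRG sigmaGB k = braidWord sigmaRG sigmaGB k') :
      ∃ q, s * wheelWord (i, j, k) = wheelWord q := by
    obtain ⟨i', hi⟩ := sL i
    obtain ⟨j', hj⟩ := sR j
    obtain ⟨k', hk⟩ := sσ
    refine ⟨(i', j', k'), ?_⟩
    simp only [wheelWord]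
    rw [← mul_assoc, hi, mul_assoc, ← mul_assoc s, hj, mul_assoc, hk]
  have of_left {s : Equiv.Perm (Fin 12)}
      (sL : ∃ i', s * braidWord autL autL' i = braidWord autL autL' i') :
      ∃ q, s * wheelWord (i, j, k) = wheelWord q := by
    obtain ⟨i', hi⟩ := sL
    exact ⟨(i', j, k), by simp only [wheelWord, ← hi, mul_assoc]⟩
  have of_right {s : Equiv.Perm (Fin 12)}
      (hs : ∀ i, s * braidWord autL autL' i = braidWord autL autL' i * s)
      (sR : ∃ j', s * braidWord autR autR' j = braidWord autR autR' j') :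
      ∃ q, s * wheelWord (i, j, k) = wheelWord q := by
    obtain ⟨j', hj⟩ := sR
    refine ⟨(i, j', k), ?_⟩
    simp only [wheelWord]
    rw [← hj, ← mul_assoc, hs, mul_assoc, ← mul_assoc s]
  rcases hg with rfl | rfl | rfl | rfl | rfl | rfl
  · exact of_color (by decide +kernel) (by decide +kernel) hσ.1
  · exact of_color (by decide +kernel) (by decide +kernel) hσ.2
  · exact of_left hL.1
  · exact of_left hL.2
  · exact of_right (by decide +kernel) hR.1
  · exact of_right (by decide +kernel) hR.2

theorem mem_wheelPairGroup {g : Equiv.Perm (Fin 12)} :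
    g ∈ wheelPairGroup ↔ ∃ p, wheelWord p = g := by
  have hgen {s : Equiv.Perm (Fin 12)}
      (hs : s ∈ ({sigmaRG, sigmaGB, autL, autL', autR, autR'} : Set (Equiv.Perm (Fin 12)))) :
      s ∈ wheelPairGroup := Subgroup.subset_closure hs
  constructor
  · intro hg
    induction hg using Subgroup.closure_induction_left with
    | one => exact ⟨(0, 0, 0), by decide⟩
    | mul_left s hs y _ ih =>
      obtain ⟨p, rfl⟩ := ih
      obtain ⟨q, hq⟩ := exists_mul_wheelWord hs p
      exact ⟨q, hq.symm⟩
    | inv_mul_cancel s hs y _ ih =>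
      obtain ⟨p, rfl⟩ := ih
      have hinv : s⁻¹ = s := by
        rcases hs with rfl | rfl | rfl | rfl | rfl | rfl <;> decide
      obtain ⟨q, hq⟩ := exists_mul_wheelWord hs p
      exact ⟨q, by rw [hinv, hq]⟩
  · rintro ⟨p, rfl⟩
    exact mul_mem (braidWord_mem (hgen (by simp)) (hgen (by simp)) _)
      (mul_mem (braidWord_mem (hgen (by simp)) (hgen (by simp)) _)
        (braidWord_mem (hgen (by simp)) (hgen (by simp)) _))

theorem card_wheelPairGroup_and (P : Equiv.Perm (Fin 12) → Prop) [DecidablePred P] :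
    Nat.card {g : Equiv.Perm (Fin 12) // g ∈ wheelPairGroup ∧ P g} =
      (Finset.univ.filter fun p => P (wheelWord p)).card := by
  rw [← Fintype.card_subtype, ← Nat.card_eq_fintype_card]
  refine (Nat.card_congr (Equiv.ofBijective
    (fun p => ⟨wheelWord p.1, mem_wheelPairGroup.2 ⟨_, rfl⟩, p.2⟩) ⟨?_, ?_⟩)).symm
  · intro p q h
    exact Subtype.ext (wheelWord_injective (Subtype.ext_iff.1 h))
  · rintro ⟨g, hg, hP⟩
    obtain ⟨p, rfl⟩ := mem_wheelPairGroup.1 hg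
    exact ⟨⟨p, hP⟩, rfl⟩

theorem exists_mem_wheelPairGroup {P : Equiv.Perm (Fin 12) → Prop} :
    (∃ g ∈ wheelPairGroup, P g) ↔ ∃ i j k, P (wheelWord (i, j, k)) := by
  simp [mem_wheelPairGroup]

/-- the group `G` generated by the colour permutations and vertex
automorphisms has order 216; the orbit of `1_L` is all of `{1_L,…,6_L}`; the
stabilizer of `1_L` has order 36 and acts transitively on `{1_R,…,6_R}`; and the
simultaneous stabilizer of `1_L` and `1_R` has order 6, with orbits `{2_L,4_L,6_L}`
and `{3_L,5_L}` on the remaining left letters. -/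
theorem wheel_two_cycle_enumeration :
    Nat.card wheelPairGroup = 216
    ∧ {x : Fin 12 | ∃ g ∈ wheelPairGroup, g 0 = x} = {0, 1, 2, 3, 4, 5}
    ∧ (Nat.card {g : Equiv.Perm (Fin 12) // g ∈ wheelPairGroup ∧ g 0 = 0} = 36
        ∧ {x : Fin 12 | ∃ g ∈ wheelPairGroup, g 0 = 0 ∧ g 6 = x}
            = {6, 7, 8, 9, 10, 11})
    ∧ (Nat.card {g : Equiv.Perm (Fin 12) // g ∈ wheelPairGroup ∧ g 0 = 0 ∧ g 6 = 6} = 6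
        ∧ {x : Fin 12 | ∃ g ∈ wheelPairGroup, g 0 = 0 ∧ g 6 = 6 ∧ g 1 = x} = {1, 3, 5}
        ∧ {x : Fin 12 | ∃ g ∈ wheelPairGroup, g 0 = 0 ∧ g 6 = 6 ∧ g 2 = x} = {2, 4}) := by
  refine ⟨?_, ?_, ⟨?_, ?_⟩, ?_, ?_, ?_⟩
  · have h := card_wheelPairGroup_and fun _ => True
    simpa using h
  · ext x
    simp only [Set.mem_ofPred_eq, exists_mem_wheelPairGroup, Set.mem_insert_iff,
      Set.mem_singleton_iff]
    revert x
    decide +kernel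
  · rw [card_wheelPairGroup_and]
    decide +kernel
  · ext x
    simp only [Set.mem_ofPred_eq, exists_mem_wheelPairGroup, Set.mem_insert_iff,
      Set.mem_singleton_iff]
    revert x
    decide +kernel
  · rw [card_wheelPairGroup_and fun g => g 0 = 0 ∧ g 6 = 6]
    decide +kernel
  all_goals
    ext x
    simp only [Set.mem_ofPred_eq, exists_mem_wheelPairGroup, Set.mem_insert_iff,
      Set.mem_singleton_iff]
    revert x
    decide +kernel
end
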